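/- arXiv:2303.11524 — 2 statements merged into one kernel-verified Lean document; each statement's English description precedes it below -/
import Mathlib

section
/- Let d ≥ 1, κ_1,…,κ_d > 0, t > 0, and let f : ℝ^d → [0,∞) be measurable, not almost everywhere zero, such that u_t(x) := ∫_{ℝ^d} h_t(x,y) f(y) ∏_{j=1}^d |y_j|^{2κ_j} dy is finite for every x ∈ ℝ^d, where h_t is the heat kernel of the Dunkl harmonic oscillator. Then the function x ↦ log( u_t(x) / h_t(x,0) ) is convex on ℝ^d. -/
open Real MeasureTheory

/-- The one-dimensional kernel `h_t^{(κ)}(u,v)`. -/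
noncomputable def hKer (κ t u v : ℝ) : ℝ :=
  ((2 : ℝ) ^ (κ + 1/2) * Real.sqrt π * Real.Gamma (κ + 1/2))⁻¹
    * Real.sinh (2*t) ^ (-(κ + 1/2))
    * Real.exp (-(1/2) * (Real.cosh (2*t) / Real.sinh (2*t)) * (u^2 + v^2))
    * ∫ s in (-1 : ℝ)..(1 : ℝ),
        (1 - s) ^ (κ - 1) * (1 + s) ^ κ * Real.exp (u * v * s / Real.sinh (2*t))

/-- The heat kernel of the Dunkl harmonic oscillator in the `ℤ₂^d` case. -/
noncomputable def hHeat {d : ℕ} (κ : Fin d → ℝ) (t : ℝ) (x y : Fin d → ℝ) : ℝ :=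
  ∏ j, hKer (κ j) t (x j) (y j)

/-- Hölder's inequality for conjugate weights, in the form that bounds the integral of a function
dominated by a weighted geometric mean. -/
theorem integral_le_rpow_mul_rpow {α : Type*} [MeasurableSpace α] {μ : Measure α}
    {f g h : α → ℝ} {a b : ℝ} (ha : 0 ≤ a) (hb : 0 ≤ b) (hab : a + b = 1)
    (hf : Integrable f μ) (hg : Integrable g μ)
    (hf0 : 0 ≤ᵐ[μ] f) (hg0 : 0 ≤ᵐ[μ] g) (hh0 : 0 ≤ᵐ[μ] h)
    (hfpos : 0 < ∫ x, f x ∂μ) (hgpos : 0 < ∫ x, g x ∂μ)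
    (hle : ∀ᵐ x ∂μ, h x ≤ f x ^ a * g x ^ b) :
    ∫ x, h x ∂μ ≤ (∫ x, f x ∂μ) ^ a * (∫ x, g x ∂μ) ^ b := by
  set F := ∫ x, f x ∂μ with hF
  set G := ∫ x, g x ∂μ with hG
  have hFG : 0 < F ^ a * G ^ b := by positivity
  have key : ∫ x, h x ∂μ ≤ ∫ x, F ^ a * G ^ b * (a / F * f x + b / G * g x) ∂μ := by
    refine integral_mono_of_nonneg hh0
      (((hf.const_mul _).add (hg.const_mul _)).const_mul _) ?_
    filter_upwards [hf0, hg0, hle] with x hfx hgx hx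
    simp only [Pi.zero_apply] at hfx hgx
    have young := Real.geom_mean_le_arith_mean2_weighted ha hb
      (div_nonneg hfx hfpos.le) (div_nonneg hgx hgpos.le) hab
    rw [Real.div_rpow hfx hfpos.le, Real.div_rpow hgx hgpos.le] at young
    calc h x ≤ f x ^ a * g x ^ b := hx
      _ = F ^ a * G ^ b * (f x ^ a / F ^ a * (g x ^ b / G ^ b)) := by
          have := (Real.rpow_pos_of_pos hfpos a).ne'
          have := (Real.rpow_pos_of_pos hgpos b).ne'
          field_simp
      _ ≤ F ^ a * G ^ b * (a * (f x / F) + b * (g x / G)) := by gcongr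
      _ = F ^ a * G ^ b * (a / F * f x + b / G * g x) := by ring
  refine key.trans_eq ?_
  rw [integral_const_mul, integral_add (hf.const_mul _) (hg.const_mul _), integral_const_mul,
    integral_const_mul, ← hF, ← hG, div_mul_cancel₀ _ hfpos.ne', div_mul_cancel₀ _ hgpos.ne', hab,
    mul_one]

/-- The unnormalised one-dimensional Dunkl kernel. -/
noncomputable def dunklExp (κ z : ℝ) : ℝ :=
  ∫ s in (-1 : ℝ)..(1 : ℝ), (1 - s) ^ (κ - 1) * (1 + s) ^ κ * Real.exp (z * s)

theorem intervalIntegrable_dunklExp {κ : ℝ} (hκ : 0 < κ) (z : ℝ) :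
    IntervalIntegrable (fun s : ℝ => (1 - s) ^ (κ - 1) * (1 + s) ^ κ * Real.exp (z * s))
      volume (-1) 1 := by
  have h : IntervalIntegrable (fun s : ℝ => (1 - s) ^ (κ - 1)) volume (-1) 1 := by
    have h0 : IntervalIntegrable (fun s : ℝ => s ^ (κ - 1)) volume 2 0 :=
      intervalIntegral.intervalIntegrable_rpow' (by linarith)
    have h1 := h0.comp_sub_left 1
    norm_num at h1
    exact h1
  simp only [mul_assoc]
  refine h.mul_continuousOn (Continuous.continuousOn ?_)
  exact ((continuous_const.add continuous_id).rpow_const fun _ => Or.inr hκ.le).mul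
    (by fun_prop)

theorem dunklExp_pos {κ : ℝ} (hκ : 0 < κ) (z : ℝ) : 0 < dunklExp κ z := by
  refine intervalIntegral.intervalIntegral_pos_of_pos_on (intervalIntegrable_dunklExp hκ z)
    (fun s hs => ?_) (by norm_num)
  have h1 : 0 < 1 - s := by linarith [hs.2]
  have h2 : 0 < 1 + s := by linarith [hs.1]
  positivity

/-- `dunklExp κ` is log-convex. -/
theorem dunklExp_le_rpow_mul_rpow {κ : ℝ} (hκ : 0 < κ) {a b : ℝ} (ha : 0 ≤ a) (hb : 0 ≤ b)
    (hab : a + b = 1) (z w : ℝ) :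
    dunklExp κ (a * z + b * w) ≤ dunklExp κ z ^ a * dunklExp κ w ^ b := by
  have hz := dunklExp_pos hκ z
  have hw := dunklExp_pos hκ w
  have hnonneg : ∀ r : ℝ, ∀ s ∈ Set.Ioc (-1 : ℝ) 1,
      0 ≤ (1 - s) ^ (κ - 1) * (1 + s) ^ κ * Real.exp (r * s) := by
    intro r s hs
    have h1 : 0 ≤ 1 - s := by linarith [hs.2]
    have h2 : 0 ≤ 1 + s := by linarith [hs.1]
    positivity
  have hae : ∀ r : ℝ, 0 ≤ᵐ[volume.restrict (Set.Ioc (-1 : ℝ) 1)]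
      fun s : ℝ => (1 - s) ^ (κ - 1) * (1 + s) ^ κ * Real.exp (r * s) := fun r =>
    (ae_restrict_mem measurableSet_Ioc).mono (hnonneg r)
  have hi := fun r => (intervalIntegrable_dunklExp hκ r).1
  simp only [dunklExp, intervalIntegral.integral_of_le (show (-1 : ℝ) ≤ 1 by norm_num)]
    at hz hw ⊢
  refine integral_le_rpow_mul_rpow ha hb hab (hi z) (hi w) (hae z) (hae w) (hae _) hz hw ?_
  filter_upwards [ae_restrict_mem measurableSet_Ioc] with s hs
  have hρ : 0 ≤ (1 - s) ^ (κ - 1) * (1 + s) ^ κ := by simpa using hnonneg 0 s hs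
  rw [Real.mul_rpow hρ (Real.exp_pos _).le, Real.mul_rpow hρ (Real.exp_pos _).le,
    mul_mul_mul_comm, ← Real.rpow_add_of_nonneg hρ ha hb, hab, Real.rpow_one, ← Real.exp_mul,
    ← Real.exp_mul, ← Real.exp_add]
  exact le_of_eq (by ring_nf)

theorem hKer_eq_mul_dunklExp (κ t u v : ℝ) :
    hKer κ t u v = ((2 : ℝ) ^ (κ + 1/2) * Real.sqrt π * Real.Gamma (κ + 1/2))⁻¹
      * Real.sinh (2*t) ^ (-(κ + 1/2))
      * Real.exp (-(1/2) * (Real.cosh (2*t) / Real.sinh (2*t)) * (u^2 + v^2))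
      * dunklExp κ (u * v / Real.sinh (2*t)) := by
  simp only [hKer, dunklExp, div_mul_eq_mul_div]

theorem hKer_pos {κ t : ℝ} (hκ : 0 < κ) (ht : 0 < t) (u v : ℝ) : 0 < hKer κ t u v := by
  have hs : 0 < Real.sinh (2*t) := Real.sinh_pos_iff.2 (by positivity)
  have hΓ : 0 < Real.Gamma (κ + 1/2) := Real.Gamma_pos_of_pos (by positivity)
  have hE := dunklExp_pos hκ (u * v / Real.sinh (2*t))
  rw [hKer_eq_mul_dunklExp]
  positivity

theorem hKer_div_hKer_zero {κ t : ℝ} (hκ : 0 < κ) (ht : 0 < t) (u v : ℝ) :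
    hKer κ t u v / hKer κ t u 0 =
      Real.exp (-(1/2) * (Real.cosh (2*t) / Real.sinh (2*t)) * v^2) / dunklExp κ 0
        * dunklExp κ (u * v / Real.sinh (2*t)) := by
  have hs : 0 < Real.sinh (2*t) := Real.sinh_pos_iff.2 (by positivity)
  have hΓ : 0 < Real.Gamma (κ + 1/2) := Real.Gamma_pos_of_pos (by positivity)
  have hE := dunklExp_pos hκ 0
  rw [div_eq_iff (hKer_pos hκ ht u 0).ne', hKer_eq_mul_dunklExp, hKer_eq_mul_dunklExp,
    mul_add, Real.exp_add]
  simp only [mul_zero, zero_div, ne_eq, OfNat.ofNat_ne_zero, not_false_eq_true, zero_pow,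
    add_zero]
  field_simp

/-- The normalised one-dimensional kernel is log-convex in its first variable. -/
theorem hKer_div_hKer_zero_le {κ t : ℝ} (hκ : 0 < κ) (ht : 0 < t) {a b : ℝ} (ha : 0 ≤ a)
    (hb : 0 ≤ b) (hab : a + b = 1) (u u' v : ℝ) :
    hKer κ t (a * u + b * u') v / hKer κ t (a * u + b * u') 0 ≤
      (hKer κ t u v / hKer κ t u 0) ^ a * (hKer κ t u' v / hKer κ t u' 0) ^ b := by
  simp only [hKer_div_hKer_zero hκ ht]
  set C := Real.exp (-(1/2) * (Real.cosh (2*t) / Real.sinh (2*t)) * v^2) / dunklExp κ 0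
  have hC : 0 ≤ C := div_nonneg (Real.exp_pos _).le (dunklExp_pos hκ 0).le
  rw [Real.mul_rpow hC (dunklExp_pos hκ _).le, Real.mul_rpow hC (dunklExp_pos hκ _).le,
    mul_mul_mul_comm, ← Real.rpow_add_of_nonneg hC ha hb, hab, Real.rpow_one]
  refine mul_le_mul_of_nonneg_left ?_ hC
  rw [show (a * u + b * u') * v / Real.sinh (2*t) =
    a * (u * v / Real.sinh (2*t)) + b * (u' * v / Real.sinh (2*t)) by ring]
  exact dunklExp_le_rpow_mul_rpow hκ ha hb hab _ _

theorem hHeat_pos {d : ℕ} {κ : Fin d → ℝ} (hκ : ∀ j, 0 < κ j) {t : ℝ} (ht : 0 < t)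
    (x y : Fin d → ℝ) : 0 < hHeat κ t x y :=
  Finset.prod_pos fun j _ => hKer_pos (hκ j) ht _ _

/-- The normalised heat kernel is log-convex in its first variable. -/
theorem hHeat_div_hHeat_zero_le {d : ℕ} {κ : Fin d → ℝ} (hκ : ∀ j, 0 < κ j) {t : ℝ}
    (ht : 0 < t) {a b : ℝ} (ha : 0 ≤ a) (hb : 0 ≤ b) (hab : a + b = 1) (x x' y : Fin d → ℝ) :
    hHeat κ t (a • x + b • x') y / hHeat κ t (a • x + b • x') 0 ≤
      (hHeat κ t x y / hHeat κ t x 0) ^ a * (hHeat κ t x' y / hHeat κ t x' 0) ^ b := by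
  have hnonneg : ∀ (j : Fin d) (u v : ℝ), 0 ≤ hKer (κ j) t u v / hKer (κ j) t u 0 :=
    fun j u v => (div_pos (hKer_pos (hκ j) ht u v) (hKer_pos (hκ j) ht u 0)).le
  simp only [hHeat, ← Finset.prod_div_distrib, Pi.zero_apply, Pi.add_apply, Pi.smul_apply,
    smul_eq_mul]
  rw [← Real.finsetProd_rpow _ _ fun j _ => hnonneg j _ _,
    ← Real.finsetProd_rpow _ _ fun j _ => hnonneg j _ _, ← Finset.prod_mul_distrib]
  exact Finset.prod_le_prod (fun j _ => hnonneg j _ _)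
    fun j _ => hKer_div_hKer_zero_le (hκ j) ht ha hb hab _ _ _

theorem ae_prod_abs_rpow_pos {d : ℕ} (κ : Fin d → ℝ) :
    ∀ᵐ y : Fin d → ℝ, 0 < ∏ j, |y j| ^ (2 * κ j) := by
  have h : ∀ j : Fin d, ∀ᵐ y : Fin d → ℝ, y j ≠ 0 := fun j =>
    (Measure.quasiMeasurePreserving_eval (fun _ : Fin d => (volume : Measure ℝ)) j).ae
      (Measure.ae_ne volume 0)
  filter_upwards [ae_all_iff.2 h] with y hy
  exact Finset.prod_pos fun j _ => Real.rpow_pos_of_pos (abs_pos.2 (hy j)) _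

/-- For `t > 0` and a nonnegative measurable `f`, not a.e. zero, such that
`u_t(x) = ∫ h_t(x,y) f(y) ∏_j |y_j|^{2κ_j} dy` is finite for every `x`, the function
`x ↦ log(u_t(x)/h_t(x,0))` is convex on `ℝ^d`. -/
theorem stmt9 (d : ℕ) (hd : 1 ≤ d) (κ : Fin d → ℝ) (hκ : ∀ j, 0 < κ j)
    (t : ℝ) (ht : 0 < t)
    (f : (Fin d → ℝ) → ℝ) (hfmeas : Measurable f) (hfnonneg : ∀ y, 0 ≤ f y)
    (hfne : ¬ (f =ᵐ[volume] 0))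
    (hint : ∀ x : Fin d → ℝ,
      Integrable (fun y => hHeat κ t x y * f y * ∏ j, |y j| ^ (2 * κ j)) volume) :
    ConvexOn ℝ Set.univ
      (fun x : Fin d → ℝ =>
        Real.log ((∫ y, hHeat κ t x y * f y * ∏ j, |y j| ^ (2 * κ j)) / hHeat κ t x 0)) := by
  have hweight : ∀ y : Fin d → ℝ, 0 ≤ f y * ∏ j, |y j| ^ (2 * κ j) := fun y =>
    mul_nonneg (hfnonneg y) (Finset.prod_nonneg fun j _ => by positivity)
  have hnonneg : ∀ x y : Fin d → ℝ, 0 ≤ hHeat κ t x y * f y * ∏ j, |y j| ^ (2 * κ j) :=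
    fun x y => by
      rw [mul_assoc]
      exact mul_nonneg (hHeat_pos hκ ht x y).le (hweight y)
  have hpos : ∀ x, 0 < ∫ y, hHeat κ t x y * f y * ∏ j, |y j| ^ (2 * κ j) := by
    intro x
    refine (integral_nonneg (hnonneg x)).lt_of_ne' fun h0 => hfne ?_
    filter_upwards [(integral_eq_zero_iff_of_nonneg (hnonneg x) (hint x)).1 h0,
      ae_prod_abs_rpow_pos κ] with y hy hw
    simpa [(hHeat_pos hκ ht x y).ne', hw.ne'] using hy
  have hquot : ∀ x, (∫ y, hHeat κ t x y * f y * ∏ j, |y j| ^ (2 * κ j)) / hHeat κ t x 0 =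
      ∫ y, hHeat κ t x y * f y * (∏ j, |y j| ^ (2 * κ j)) / hHeat κ t x 0 := fun x =>
    (integral_div _ _).symm
  have hquot_pos : ∀ x,
      0 < (∫ y, hHeat κ t x y * f y * ∏ j, |y j| ^ (2 * κ j)) / hHeat κ t x 0 := fun x =>
    div_pos (hpos x) (hHeat_pos hκ ht x 0)
  have hquot_nonneg : ∀ x y : Fin d → ℝ,
      0 ≤ hHeat κ t x y * f y * (∏ j, |y j| ^ (2 * κ j)) / hHeat κ t x 0 := fun x y =>
    div_nonneg (hnonneg x y) (hHeat_pos hκ ht x 0).le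
  refine ⟨convex_univ, fun x _ x' _ a b ha hb hab => ?_⟩
  simp only [smul_eq_mul]
  rw [← Real.log_rpow (hquot_pos x), ← Real.log_rpow (hquot_pos x'),
    ← Real.log_mul (Real.rpow_pos_of_pos (hquot_pos x) a).ne'
      (Real.rpow_pos_of_pos (hquot_pos x') b).ne']
  refine Real.log_le_log (hquot_pos _) ?_
  simp only [hquot] at hquot_pos ⊢
  refine integral_le_rpow_mul_rpow ha hb hab ((hint x).div_const _) ((hint x').div_const _)
    (ae_of_all _ (hquot_nonneg x)) (ae_of_all _ (hquot_nonneg x')) (ae_of_all _ (hquot_nonneg _))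
    (hquot_pos x) (hquot_pos x') (ae_of_all _ fun y => ?_)
  have hsplit : ∀ z : Fin d → ℝ,
      hHeat κ t z y * f y * (∏ j, |y j| ^ (2 * κ j)) / hHeat κ t z 0 =
        hHeat κ t z y / hHeat κ t z 0 * (f y * ∏ j, |y j| ^ (2 * κ j)) := fun z => by ring
  have hratio : ∀ z, 0 ≤ hHeat κ t z y / hHeat κ t z 0 := fun z =>
    (div_pos (hHeat_pos hκ ht z y) (hHeat_pos hκ ht z 0)).le
  rw [hsplit, hsplit, hsplit, Real.mul_rpow (hratio x) (hweight y),
    Real.mul_rpow (hratio x') (hweight y), mul_mul_mul_comm,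
    ← Real.rpow_add_of_nonneg (hweight y) ha hb, hab, Real.rpow_one]
  exact mul_le_mul_of_nonneg_right (hHeat_div_hHeat_zero_le hκ ht ha hb hab x x' y) (hweight y)
end

section
/- Let d ≥ 1, κ_1,…,κ_d > 0, λ_κ = Σ_{j=1}^d κ_j, and T ∈ (0,∞]. Let u be a positive C^{1,2} function on [0,T) × ℝ^d satisfying the Dunkl heat equation ∂_t u(t,x) = Δ_κ u(t,·)(x) at every (t,x) with t ∈ (0,T) and x_j ≠ 0 for all j, and assume u is represented by the Dunkl heat kernel: u(t,x) = ∫_{ℝ^d} u(0,y) p_t(x,y) ∏_{j=1}^d |y_j|^{2κ_j} dy and ∂_t u(t,x) = ∫_{ℝ^d} u(0,y) ∂_t p_t(x,y) ∏_{j=1}^d |y_j|^{2κ_j} dy for all (t,x) ∈ (0,T) × ℝ^d, with differentiation in x allowed under the integral sign. Then −Δ_κ(log u(t,·))(x) ≤ (d + 2λ_κ)/(2t) for every t ∈ (0,T) and every x with x_j ≠ 0 for all j. -/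
open Real MeasureTheory

/-- Partial derivative `∂f/∂x_j` at `x`. -/
noncomputable def pd {d : ℕ} (f : (Fin d → ℝ) → ℝ) (j : Fin d) (x : Fin d → ℝ) : ℝ :=
  deriv (fun s => f (Function.update x j s)) (x j)

/-- The `ℤ₂^d` Dunkl Laplacian
`Δ_κ f(x) = Σ_j [ ∂²_j f(x) + (κ_j/x_j²)(2 x_j ∂_j f(x) − f(x) + f(σ_j x)) ]`. -/
noncomputable def dunklLapZ2 {d : ℕ} (κ : Fin d → ℝ) (f : (Fin d → ℝ) → ℝ)
    (x : Fin d → ℝ) : ℝ :=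
  ∑ j, (pd (fun z => pd f j z) j x
    + κ j / (x j) ^ 2 * (2 * x j * pd f j x - f x + f (Function.update x j (-(x j)))))

/-- The one-dimensional Dunkl heat kernel `p_t^{(κ)}(u,v)`. -/
noncomputable def pKer (κ t u v : ℝ) : ℝ :=
  (Real.Gamma (κ + 1/2) * (2*t) ^ (κ + 1/2))⁻¹ * Real.exp (-(u^2 + v^2) / (4*t))
    * (Real.Gamma (κ + 1/2) / (Real.sqrt π * Real.Gamma κ))
    * ∫ s in (-1 : ℝ)..(1 : ℝ),
        (1 - s) ^ (κ - 1) * (1 + s) ^ κ * Real.exp (s * u * v / (2*t))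

/-- The Dunkl heat kernel in the `ℤ₂^d` case: `p_t(x,y) = ∏_j p_t^{(κ_j)}(x_j,y_j)`. -/
noncomputable def pHeat {d : ℕ} (κ : Fin d → ℝ) (t : ℝ) (x y : Fin d → ℝ) : ℝ :=
  ∏ j, pKer (κ j) t (x j) (y j)

/-- A positive function is log-convex as soon as all its exponential tilts are convex. -/
lemma convexOn_log_of_forall_exp_mul {w : ℝ → ℝ} (hw : ∀ s, 0 < w s)
    (h : ∀ l : ℝ, ConvexOn ℝ Set.univ (fun s => Real.exp (l * s) * w s)) :
    ConvexOn ℝ Set.univ (fun s => Real.log (w s)) := by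
  refine ⟨convex_univ, fun p _ q _ a b ha hb hab => ?_⟩
  rcases eq_or_ne p q with rfl | hpq
  · simp [← add_mul, hab]
  have hqp : q - p ≠ 0 := sub_ne_zero.2 hpq.symm
  obtain ⟨l, hl⟩ : ∃ l : ℝ, l * p + Real.log (w p) = l * q + Real.log (w q) :=
    ⟨(Real.log (w p) - Real.log (w q)) / (q - p), by field_simp; ring⟩
  have hexp : ∀ s, Real.exp (l * s) * w s = Real.exp (l * s + Real.log (w s)) := fun s => by
    rw [Real.exp_add, Real.exp_log (hw s)]
  have key := (h l).2 (Set.mem_univ p) (Set.mem_univ q) ha hb hab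
  simp only [hexp, ← hl, ← add_smul, hab, one_smul, Real.exp_le_exp] at key
  simp only [smul_eq_mul] at key ⊢
  linear_combination key + b * hl - (l * p + Real.log (w p)) * hab

/-- An integral of a family of convex functions is convex. -/
lemma convexOn_integral {α : Type*} [MeasurableSpace α] {μ : Measure α} {F : ℝ → α → ℝ}
    (hint : ∀ s, Integrable (F s) μ)
    (hF : ∀ᵐ y ∂μ, ConvexOn ℝ Set.univ (fun s => F s y)) :
    ConvexOn ℝ Set.univ (fun s => ∫ y, F s y ∂μ) := by
  refine ⟨convex_univ, fun p _ q _ a b ha hb hab => ?_⟩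
  simp only [smul_eq_mul]
  rw [← integral_const_mul, ← integral_const_mul,
    ← integral_add ((hint p).const_mul a) ((hint q).const_mul b)]
  refine integral_mono_ae (hint _) (((hint p).const_mul a).add ((hint q).const_mul b)) ?_
  filter_upwards [hF] with y hy
  exact hy.2 (Set.mem_univ p) (Set.mem_univ q) ha hb hab

/-- The Jacobi weight in the integral representation of the Dunkl kernel is integrable. -/
lemma intervalIntegrable_jacobi_weight {κ : ℝ} (hκ : 0 < κ) :
    IntervalIntegrable (fun s : ℝ => (1 - s) ^ (κ - 1) * (1 + s) ^ κ) volume (-1) 1 := by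
  have h : IntervalIntegrable (fun s : ℝ => s ^ (κ - 1)) volume 2 0 :=
    intervalIntegral.intervalIntegrable_rpow' (by linarith)
  have h' := h.comp_sub_left 1
  norm_num at h'
  refine h'.mul_continuousOn (Continuous.continuousOn ?_)
  exact (continuous_const.add continuous_id).rpow_const fun _ => Or.inr hκ.le

lemma convexOn_exp_mul (c : ℝ) : ConvexOn ℝ Set.univ (fun s : ℝ => Real.exp (c * s)) :=
  convexOn_exp.comp_linearMap (c • (LinearMap.id : ℝ →ₗ[ℝ] ℝ))

lemma pKer_nonneg {κ t : ℝ} (hκ : 0 < κ) (ht : 0 < t) (u v : ℝ) : 0 ≤ pKer κ t u v := by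
  have h1 : 0 < Real.Gamma κ := Real.Gamma_pos_of_pos hκ
  have h2 : 0 < Real.Gamma (κ + 1 / 2) := Real.Gamma_pos_of_pos (by linarith)
  have h3 : 0 ≤ ∫ s in (-1 : ℝ)..(1 : ℝ),
      (1 - s) ^ (κ - 1) * (1 + s) ^ κ * Real.exp (s * u * v / (2 * t)) := by
    refine intervalIntegral.integral_nonneg (by norm_num) fun s hs => ?_
    have := Real.rpow_nonneg (sub_nonneg.2 hs.2) (κ - 1)
    have := Real.rpow_nonneg (by linarith [hs.1] : 0 ≤ 1 + s) κ
    positivity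
  unfold pKer
  positivity

/-- Up to the Gaussian factor, the Dunkl heat kernel is a Laplace transform of a positive measure,
so every exponential tilt of it is convex. -/
lemma convexOn_exp_mul_pKer {κ t : ℝ} (hκ : 0 < κ) (ht : 0 < t) (l v : ℝ) :
    ConvexOn ℝ Set.univ
      (fun s => Real.exp (l * s) * (Real.exp (s ^ 2 / (4 * t)) * pKer κ t s v)) := by
  have h1 : 0 < Real.Gamma κ := Real.Gamma_pos_of_pos hκ
  have h2 : 0 < Real.Gamma (κ + 1 / 2) := Real.Gamma_pos_of_pos (by linarith)
  have hconv : ConvexOn ℝ Set.univ (fun s => ∫ r in Set.Ioc (-1 : ℝ) 1,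
      (1 - r) ^ (κ - 1) * (1 + r) ^ κ * Real.exp ((l + r * v / (2 * t)) * s)) := by
    refine convexOn_integral (fun s => ?_) ?_
    · rw [← IntegrableOn, ← intervalIntegrable_iff_integrableOn_Ioc_of_le (by norm_num)]
      exact (intervalIntegrable_jacobi_weight hκ).mul_continuousOn (by fun_prop)
    · refine (ae_restrict_iff' measurableSet_Ioc).2 (Filter.Eventually.of_forall fun r hr => ?_)
      exact (convexOn_exp_mul _).smul (mul_nonneg (Real.rpow_nonneg (sub_nonneg.2 hr.2) _)
        (Real.rpow_nonneg (by linarith [hr.1]) _))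
  have hc : 0 ≤ (Real.Gamma (κ + 1 / 2) * (2 * t) ^ (κ + 1 / 2))⁻¹
      * Real.exp (-v ^ 2 / (4 * t))
      * (Real.Gamma (κ + 1 / 2) / (Real.sqrt π * Real.Gamma κ)) := by positivity
  refine (hconv.smul hc).congr fun s _ => ?_
  have he : Real.exp (-v ^ 2 / (4 * t))
      = Real.exp (s ^ 2 / (4 * t)) * Real.exp (-(s ^ 2 + v ^ 2) / (4 * t)) := by
    rw [← Real.exp_add]; congr 1; ring
  have hi : (∫ r in Set.Ioc (-1 : ℝ) 1,
      (1 - r) ^ (κ - 1) * (1 + r) ^ κ * Real.exp ((l + r * v / (2 * t)) * s))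
      = Real.exp (l * s) * ∫ r in (-1 : ℝ)..1,
        (1 - r) ^ (κ - 1) * (1 + r) ^ κ * Real.exp (r * s * v / (2 * t)) := by
    rw [intervalIntegral.integral_of_le (by norm_num), ← integral_const_mul]
    congr 1 with r
    rw [show (l + r * v / (2 * t)) * s = l * s + r * s * v / (2 * t) by ring, Real.exp_add]
    ring
  simp only [smul_eq_mul, pKer]
  rw [hi, he]
  ring

/-- One-dimensional Dunkl Laplacian bound for a `C²` function which is convex up to a quadratic. -/
lemma neg_dunkl_le_of_convexOn_add_sq {h : ℝ → ℝ} (hh : ContDiff ℝ 2 h) {κ t a : ℝ}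
    (hκ : 0 ≤ κ) (ha : a ≠ 0)
    (hconv : ConvexOn ℝ Set.univ (fun s => s ^ 2 / (4 * t) + h s)) :
    -(deriv (deriv h) a + κ / a ^ 2 * (2 * a * deriv h a - h a + h (-a)))
      ≤ (1 + 2 * κ) / (2 * t) := by
  have hd1 : Differentiable ℝ h := hh.differentiable (by norm_num)
  have hd2 : Differentiable ℝ (deriv h) :=
    ((contDiff_succ_iff_deriv (n := 1)).1 hh).2.2.differentiable (by norm_num)
  have hg : ∀ s, HasDerivAt (fun s => s ^ 2 / (4 * t) + h s) (s / (2 * t) + deriv h s) s :=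
    fun s => (((hasDerivAt_pow 2 s).div_const (4 * t)).add (hd1 s).hasDerivAt).congr_deriv (by
      norm_num
      ring)
  have hg' : deriv (fun s => s ^ 2 / (4 * t) + h s) = fun s => s / (2 * t) + deriv h s :=
    funext fun s => (hg s).deriv
  have hmono : Monotone (fun s => s / (2 * t) + deriv h s) := by
    rw [← monotoneOn_univ, ← hg']
    exact hconv.monotoneOn_deriv fun s _ => (hg s).differentiableAt
  have h2 : 0 ≤ 1 / (2 * t) + deriv (deriv h) a := by
    rw [← (((hasDerivAt_id a).div_const (2 * t)).add (hd2 a).hasDerivAt).deriv]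
    exact hmono.deriv_nonneg
  have htan : 0 ≤ 2 * a * (a / (2 * t) + deriv h a) - h a + h (-a) := by
    rcases lt_or_gt_of_ne ha with hneg | hpos
    · have := hconv.le_slope_of_hasDerivAt (Set.mem_univ a) (Set.mem_univ (-a))
        (by linarith) (hg a)
      rw [slope_def_field, le_div_iff₀ (by linarith)] at this
      simp only [neg_sq] at this
      linarith
    · have := hconv.slope_le_of_hasDerivAt (Set.mem_univ (-a)) (Set.mem_univ a)
        (by linarith) (hg a)
      rw [slope_def_field, div_le_iff₀ (by linarith)] at this
      simp only [neg_sq] at this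
      linarith
  have h3 : 0 ≤ κ / a ^ 2 * (2 * a * (a / (2 * t) + deriv h a) - h a + h (-a)) :=
    mul_nonneg (by positivity) htan
  have h4 : κ / a ^ 2 * (2 * a * (a / (2 * t) + deriv h a) - h a + h (-a))
      = κ / t + κ / a ^ 2 * (2 * a * deriv h a - h a + h (-a)) := by
    field_simp
    ring
  have h5 : (1 + 2 * κ) / (2 * t) = 1 / (2 * t) + κ / t := by ring
  linarith

lemma pHeat_update {d : ℕ} (κ : Fin d → ℝ) (t : ℝ) (x y : Fin d → ℝ) (j : Fin d) (s : ℝ) :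
    pHeat κ t (Function.update x j s) y
      = pKer (κ j) t s (y j) * ∏ i ∈ Finset.univ.erase j, pKer (κ i) t (x i) (y i) := by
  rw [pHeat, ← Finset.mul_prod_erase _ _ (Finset.mem_univ j), Function.update_self]
  congr 1
  refine Finset.prod_congr rfl fun i hi => ?_
  rw [Function.update_of_ne (Finset.ne_of_mem_erase hi)]

/-- **Li–Yau inequality for positive solutions of the Dunkl heat equation** (`ℤ₂^d`
case): if `u` is a positive `C^{1,2}` solution of `∂_t u = Δ_κ u` represented by the
Dunkl heat kernel `p_t` (with differentiation in `x` allowed under the integral sign),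
then `−Δ_κ(log u(t,·))(x) ≤ (d + 2λ_κ)/(2t)`. -/
theorem stmt12 (d : ℕ) (hd : 1 ≤ d) (κ : Fin d → ℝ) (hκ : ∀ j, 0 < κ j)
    (lamκ : ℝ) (hlam : lamκ = ∑ j, κ j)
    (T : EReal) (hT : 0 < T)
    (u : ℝ → (Fin d → ℝ) → ℝ)
    (hupos : ∀ (t : ℝ) x, 0 ≤ t → (t : EReal) < T → 0 < u t x)
    (huC1 : ∀ x, ContDiffOn ℝ 1 (fun s => u s x) {s : ℝ | 0 < s ∧ (s : EReal) < T})
    (huC2 : ∀ (t : ℝ), 0 < t → (t : EReal) < T → ContDiff ℝ 2 (fun z => u t z))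
    -- `u` solves the Dunkl heat equation `∂_t u = Δ_κ u` at every regular point
    (hPDE : ∀ (t : ℝ) x, 0 < t → (t : EReal) < T → (∀ j, x j ≠ 0) →
      deriv (fun s => u s x) t = dunklLapZ2 κ (fun z => u t z) x)
    -- representation of `u` and `∂_t u` by the Dunkl heat kernel
    (hrepint : ∀ (t : ℝ) x, 0 < t → (t : EReal) < T →
      Integrable (fun y => u 0 y * pHeat κ t x y * ∏ j, |y j| ^ (2 * κ j)) volume)
    (hrep : ∀ (t : ℝ) x, 0 < t → (t : EReal) < T →
      u t x = ∫ y, u 0 y * pHeat κ t x y * ∏ j, |y j| ^ (2 * κ j))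
    (hreptint : ∀ (t : ℝ) x, 0 < t → (t : EReal) < T →
      Integrable
        (fun y => u 0 y * deriv (fun s => pHeat κ s x y) t * ∏ j, |y j| ^ (2 * κ j)) volume)
    (hrept : ∀ (t : ℝ) x, 0 < t → (t : EReal) < T →
      deriv (fun s => u s x) t
        = ∫ y, u 0 y * deriv (fun s => pHeat κ s x y) t * ∏ j, |y j| ^ (2 * κ j))
    -- first-order derivatives in `x` may be taken under the integral sign
    (hgradint : ∀ (t : ℝ) x (j : Fin d), 0 < t → (t : EReal) < T →
      Integrable
        (fun y => u 0 y * pd (fun z => pHeat κ t z y) j x * ∏ i, |y i| ^ (2 * κ i)) volume)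
    (hgrad : ∀ (t : ℝ) x (j : Fin d), 0 < t → (t : EReal) < T →
      pd (fun z => u t z) j x
        = ∫ y, u 0 y * pd (fun z => pHeat κ t z y) j x * ∏ i, |y i| ^ (2 * κ i))
    -- second-order derivatives in `x` may be taken under the integral sign
    (hlapint : ∀ (t : ℝ) x (j : Fin d), 0 < t → (t : EReal) < T →
      Integrable
        (fun y => u 0 y * pd (fun z => pd (fun w => pHeat κ t w y) j z) j x
          * ∏ i, |y i| ^ (2 * κ i)) volume)
    (hlap : ∀ (t : ℝ) x (j : Fin d), 0 < t → (t : EReal) < T →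
      pd (fun z => pd (fun w => u t w) j z) j x
        = ∫ y, u 0 y * pd (fun z => pd (fun w => pHeat κ t w y) j z) j x
            * ∏ i, |y i| ^ (2 * κ i)) :
    ∀ (t : ℝ) x, 0 < t → (t : EReal) < T → (∀ j, x j ≠ 0) →
      -dunklLapZ2 κ (fun z => Real.log (u t z)) x
        ≤ ((d : ℝ) + 2 * lamκ) / (2*t) := by
  intro t x ht htT hx
  have h0 : ∀ y, 0 ≤ u 0 y := fun y => (hupos 0 y le_rfl (by simpa using hT)).le
  have hcoord : ∀ j, -(deriv (deriv fun s => Real.log (u t (Function.update x j s))) (x j)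
      + κ j / (x j) ^ 2 * (2 * x j * deriv (fun s => Real.log (u t (Function.update x j s))) (x j)
        - Real.log (u t (Function.update x j (x j)))
        + Real.log (u t (Function.update x j (-(x j)))))) ≤ (1 + 2 * κ j) / (2 * t) := by
    intro j
    refine neg_dunkl_le_of_convexOn_add_sq (h := fun s => Real.log (u t (Function.update x j s)))
      (ContDiff.log ((huC2 t ht htT).comp (contDiff_update 2 x j))
        fun s => (hupos t _ ht.le htT).ne') (hκ j).le (hx j) ?_
    have hpos : ∀ s, 0 < Real.exp (s ^ 2 / (4 * t)) * u t (Function.update x j s) :=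
      fun s => mul_pos (Real.exp_pos _) (hupos t _ ht.le htT)
    refine (convexOn_log_of_forall_exp_mul hpos fun l => ?_).congr fun s _ => by
      simp only
      rw [Real.log_mul (Real.exp_pos _).ne' (hupos t _ ht.le htT).ne', Real.log_exp]
    simp only [hrep t _ ht htT, ← integral_const_mul]
    refine convexOn_integral
      (fun s => ((hrepint t _ ht htT).const_mul _).const_mul _)
      (Filter.Eventually.of_forall fun y => ?_)
    have hc : 0 ≤ u 0 y * (∏ i ∈ Finset.univ.erase j, pKer (κ i) t (x i) (y i))
        * ∏ i, |y i| ^ (2 * κ i) :=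
      mul_nonneg (mul_nonneg (h0 y) (Finset.prod_nonneg fun i _ => pKer_nonneg (hκ i) ht _ _))
        (Finset.prod_nonneg fun i _ => Real.rpow_nonneg (abs_nonneg _) _)
    refine ((convexOn_exp_mul_pKer (hκ j) ht l (y j)).smul hc).congr fun s _ => ?_
    simp only [smul_eq_mul, pHeat_update]
    ring
  have hsum : ((d : ℝ) + 2 * lamκ) / (2 * t) = ∑ j, (1 + 2 * κ j) / (2 * t) := by
    rw [← Finset.sum_div, Finset.sum_add_distrib, ← Finset.mul_sum, hlam]
    simp
  rw [hsum, dunklLapZ2, ← Finset.sum_neg_distrib]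
  refine Finset.sum_le_sum fun j _ => ?_
  have hj := hcoord j
  rw [Function.update_eq_self] at hj
  simpa only [pd, Function.update_self, Function.update_idem] using hj
end
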